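/- Let r > s ≥ 1 be integers. If n ≥ s(⌈(s+1)/2⌉ + 1) + 1 + (s+1)(r−s), then the set LS_n(r,s) of n×n real matrices is not closed in the Euclidean topology on ℝ^{n×n}. -/

import Mathlib

open Matrix

/-- The number of nonzero entries of a matrix (the "ℓ₀ norm"). -/
noncomputable def sparsity {I J : Type*} [Fintype I] [Fintype J] (S : Matrix I J ℝ) : ℕ :=
  Nat.card {p : I × J // S p.1 p.2 ≠ 0}

/-- The set of `m × n` real matrices expressible as a rank `≤ r` matrix plus a
matrix with at most `s` nonzero entries. -/
def LS (m n r s : ℕ) : Set (Matrix (Fin m) (Fin n) ℝ) :=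
  {M | ∃ L S : Matrix (Fin m) (Fin n) ℝ, M = L + S ∧ L.rank ≤ r ∧ sparsity S ≤ s}

/-- The matrix rigidity: minimal number of entries that must be changed to reduce
the rank to at most `r`. -/
noncomputable def Rig {I J : Type*} [Fintype I] [Fintype J] (M : Matrix I J ℝ) (r : ℕ) : ℕ :=
  sInf {k | ∃ S : Matrix I J ℝ, (M - S).rank ≤ r ∧ sparsity S = k}

/-- The Frobenius norm of a matrix. -/
noncomputable def frobNorm {I J : Type*} [Fintype I] [Fintype J] (A : Matrix I J ℝ) : ℝ :=
  Real.sqrt (∑ i, ∑ j, (A i j) ^ 2)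

/-- A symmetric matrix of size `m + 1` bordered by ones, whose core is `t` plus the Gram matrix of
the powers `1, …, q` of the nodes `0, …, m - 1`. -/
noncomputable def borderedGram (m q : ℕ) (t : ℝ) : Matrix (Fin (m + 1)) (Fin (m + 1)) ℝ :=
  Matrix.of fun i j ↦ Fin.cases (Fin.cases 0 (fun _ ↦ 1) j)
    (fun i' ↦ Fin.cases 1
      (fun j' ↦ t + ∑ k : Fin q, (i' : ℝ) ^ (k + 1 : ℕ) * (j' : ℝ) ^ (k + 1 : ℕ)) j) i

lemma continuous_borderedGram (m q : ℕ) : Continuous (borderedGram m q) := by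
  refine continuous_matrix fun i j ↦ ?_
  cases i using Fin.cases <;> cases j using Fin.cases <;> simp only [borderedGram, Matrix.of_apply,
    Fin.cases_zero, Fin.cases_succ] <;> fun_prop

lemma borderedGram_mem_LS {m q s : ℕ} (hs : 1 ≤ s) {t : ℝ} (ht : t ≠ 0) :
    borderedGram m q t ∈ LS (m + 1) (m + 1) (q + 1) s := by
  let W : Matrix (Fin (m + 1)) (Fin (q + 1)) ℝ := Matrix.of fun i k ↦
    Fin.cases (Fin.cases 1 (fun _ ↦ 0) k)
      (fun i' ↦ Fin.cases t (fun k' ↦ (i' : ℝ) ^ (k' + 1 : ℕ)) k) i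
  let Z : Matrix (Fin (q + 1)) (Fin (m + 1)) ℝ := Matrix.of fun k j ↦
    Fin.cases (Fin.cases t⁻¹ (fun _ ↦ 0) k)
      (fun j' ↦ Fin.cases 1 (fun k' ↦ (j' : ℝ) ^ (k' + 1 : ℕ)) k) j
  refine ⟨W * Z, Matrix.single 0 0 (-t⁻¹), ?_, ?_, ?_⟩
  · ext i j
    cases i using Fin.cases <;> cases j using Fin.cases <;>
      simp [borderedGram, W, Z, Matrix.mul_apply, Fin.sum_univ_succ,
        (Fin.succ_ne_zero _).symm, ht]
  · exact (Matrix.rank_mul_le_left W Z).trans (Matrix.rank_le_width W)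
  · refine le_trans ?_ hs
    refine Finite.card_le_one_iff_subsingleton.2 ⟨?_⟩
    rintro ⟨⟨a, b⟩, h⟩ ⟨⟨c, d⟩, h'⟩
    simp only [Matrix.single_apply, ne_eq, ite_eq_right_iff, Classical.not_imp] at h h'
    obtain ⟨⟨⟨rfl, rfl⟩, -⟩, ⟨rfl, rfl⟩, -⟩ := And.intro h h'
    rfl

/-- Row and column selections, avoiding the border, on which a matrix with few nonzero entries
vanishes together with the selected parts of the border. -/
lemma exists_selection_of_sparsity_le {m r s : ℕ} (hm : r + s ≤ m)
    {S : Matrix (Fin (m + 1)) (Fin (m + 1)) ℝ} (hS : sparsity S ≤ s) :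
    ∃ R C : Fin r ↪ Fin m, (∀ a j, S (R a).succ j = 0) ∧ ∀ b, S 0 (C b).succ = 0 := by
  classical
  let T : Finset (Fin (m + 1) × Fin (m + 1)) := {p | S p.1 p.2 ≠ 0}
  have hT : T.card ≤ s := by
    have : sparsity S = T.card := by
      rw [sparsity, Nat.card_eq_fintype_card, Fintype.card_subtype]
    omega
  have key (f : Fin (m + 1) × Fin (m + 1) → Fin (m + 1)) :
      ∃ R : Fin r ↪ Fin m, ∀ a, ∀ p ∈ T, f p ≠ (R a).succ := by
    let G : Finset (Fin m) := {i | i.succ ∉ T.image f}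
    have hG : r ≤ G.card := by
      have h1 : (Finset.univ \ G).card ≤ s := by
        refine le_trans ?_ (Finset.card_image_le.trans hT : (T.image f).card ≤ s)
        refine Finset.card_le_card_of_injOn Fin.succ (fun i hi ↦ ?_) (Fin.succ_injective _).injOn
        simpa [G] using hi
      have h2 := Finset.card_sdiff_add_card_eq_card (Finset.subset_univ G)
      rw [Finset.card_univ, Fintype.card_fin] at h2
      omega
    refine ⟨(Fin.castLEEmb hG).trans (G.orderEmbOfFin rfl).toEmbedding, fun a p hp h ↦ ?_⟩
    have hmem : G.orderEmbOfFin rfl (Fin.castLE hG a) ∈ G := Finset.orderEmbOfFin_mem _ _ _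
    exact (Finset.mem_filter.1 hmem).2 (Finset.mem_image.2 ⟨p, hp, h⟩)
  obtain ⟨R, hR⟩ := key Prod.fst
  obtain ⟨C, hC⟩ := key Prod.snd
  refine ⟨R, C, fun a j ↦ ?_, fun b ↦ ?_⟩
  · by_contra h
    exact hR a ((R a).succ, j) (by simpa [T] using h) rfl
  · by_contra h
    exact hC b (0, (C b).succ) (by simpa [T] using h) rfl

/-- A matrix bordered by ones whose core is a Gram matrix of the powers `1, …, q` at `q + 1`
distinct row nodes and `q + 1` distinct column nodes is nonsingular, whatever its corner. -/
lemma det_bordered_ne_zero {q : ℕ} {a b : Fin (q + 1) → ℝ} (ha : Function.Injective a)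
    (hb : Function.Injective b) {N : Matrix (Fin (q + 2)) (Fin (q + 2)) ℝ}
    (h₁ : ∀ j : Fin (q + 1), N 0 j.succ = 1) (h₂ : ∀ i : Fin (q + 1), N i.succ 0 = 1)
    (h₃ : ∀ i j : Fin (q + 1),
      N i.succ j.succ = ∑ k : Fin q, a i ^ (k + 1 : ℕ) * b j ^ (k + 1 : ℕ)) :
    N.det ≠ 0 := by
  intro hdet
  obtain ⟨x, hx, hNx⟩ := Matrix.exists_mulVec_eq_zero_iff.2 hdet
  let c : Fin (q + 1) → ℝ :=
    Fin.cons (x 0) fun k : Fin q ↦ ∑ j, b j ^ (k + 1 : ℕ) * x j.succ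
  have hc : c = 0 := by
    refine Matrix.eq_zero_of_forall_index_sum_pow_mul_eq_zero ha fun i ↦ ?_
    have := congrFun hNx i.succ
    simp only [Matrix.mulVec, dotProduct, Fin.sum_univ_succ (n := q + 1), h₂, h₃, Pi.zero_apply,
      Finset.sum_mul] at this
    rw [Finset.sum_comm] at this
    rw [Fin.sum_univ_succ]
    simpa [c, Finset.mul_sum, mul_assoc] using this
  have hx0 : x 0 = 0 := congrFun hc 0
  have hx' : (fun j : Fin (q + 1) ↦ x j.succ) = 0 := by
    refine Matrix.eq_zero_of_forall_pow_sum_mul_pow_eq_zero hb fun k ↦ ?_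
    cases k using Fin.cases with
    | zero =>
      have := congrFun hNx 0
      simpa [Matrix.mulVec, dotProduct, Fin.sum_univ_succ (n := q + 1), h₁, hx0] using this
    | succ k =>
      have := congrFun hc k.succ
      simpa [c, mul_comm] using this
  refine hx (funext fun i ↦ ?_)
  cases i using Fin.cases with
  | zero => exact hx0
  | succ j => exact congrFun hx' j

lemma borderedGram_zero_notMem_LS {m q s : ℕ} (hm : q + 1 + s ≤ m) :
    borderedGram m q 0 ∉ LS (m + 1) (m + 1) (q + 1) s := by
  rintro ⟨L, S, hLS, hL, hS⟩
  obtain ⟨R, C, hR, hC⟩ := exists_selection_of_sparsity_le hm hS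
  let N : Matrix (Fin (q + 2)) (Fin (q + 2)) ℝ :=
    L.submatrix (Fin.cons 0 fun i ↦ (R i).succ) (Fin.cons 0 fun j ↦ (C j).succ)
  have hent (i j) (h : S i j = 0) : L i j = borderedGram m q 0 i j := by
    simp [hLS, h]
  have hdet : N.det ≠ 0 := by
    refine det_bordered_ne_zero (a := fun i ↦ (R i : ℝ)) (b := fun j ↦ (C j : ℝ))
      (fun i j h ↦ R.injective (Fin.ext (Nat.cast_injective h)))
      (fun i j h ↦ C.injective (Fin.ext (Nat.cast_injective h))) (fun j ↦ ?_) (fun i ↦ ?_)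
      fun i j ↦ ?_
    · simpa [N, borderedGram] using hent _ _ (hC j)
    · simpa [N, borderedGram] using hent _ _ (hR i 0)
    · simpa [N, borderedGram] using hent _ _ (hR i (C j).succ)
  have hrank : N.rank = q + 2 := by
    simpa using Matrix.rank_of_isUnit N ((Matrix.isUnit_iff_isUnit_det N).2 hdet.isUnit)
  have : N.rank ≤ L.rank := Matrix.rank_submatrix_le _ _ _
  omega

/-- For `r > s ≥ 1`, if `n ≥ s(⌈(s+1)/2⌉ + 1) + 1 + (s+1)(r−s)` then `LS_n(r,s)`
is not closed. -/
theorem LS_not_closed_r_gt_s (n r s : ℕ) (hs : 1 ≤ s) (hrs : s < r)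
    (hn : s * (⌈((s : ℚ) + 1) / 2⌉₊ + 1) + 1 + (s + 1) * (r - s) ≤ n) :
    ¬ IsClosed (LS n n r s) := by
  have hceil : 1 ≤ ⌈((s : ℚ) + 1) / 2⌉₊ := Nat.one_le_ceil_iff.2 (by positivity)
  obtain ⟨d, rfl⟩ : ∃ d, r = s + d + 1 := ⟨r - s - 1, by omega⟩
  have hbound : s + d + 1 + s + 1 ≤ n := by
    rw [show s + d + 1 - s = d + 1 by omega] at hn
    nlinarith [Nat.mul_le_mul_left s hceil, Nat.zero_le (s * d)]
  obtain ⟨m, rfl⟩ : ∃ m, n = m + 1 := ⟨n - 1, by omega⟩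
  intro hclosed
  have hsub : ({0}ᶜ : Set ℝ) ⊆ borderedGram m (s + d) ⁻¹' LS (m + 1) (m + 1) (s + d + 1) s :=
    fun t ht ↦ borderedGram_mem_LS hs ht
  have hmem := (hclosed.preimage (continuous_borderedGram m (s + d))).closure_subset_iff.2 hsub
    (dense_compl_singleton (0 : ℝ) 0)
  exact borderedGram_zero_notMem_LS (by omega) hmem
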